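/- arXiv:1612.00156 — 2 statements merged into one kernel-verified Lean document; each statement's English description precedes it below -/
import Mathlib

section
/- Let a ≥ 1 and b ≥ 2a be integers, let r := b − 2a + 1, and consider the directed graph D_{a,b}. The function d defined by d_v = 1/r for every internal vertex v and d_s = d_t = 0 is feasible for the Path-Blocking-LP on D_{a,b} with terminals s and t. -/
/-- Vertices of the graph `D_{a,b}`: the terminals `s`, `t`, and internal vertices
`inner i j` (intended range `1 ≤ i ≤ a`, `1 ≤ j ≤ b`). -/
inductive DV : Type
  | s : DV
  | t : DV
  | inner : ℕ → ℕ → DV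
  deriving DecidableEq

/-- The vertex `(i, j)` of `D_{a,b}`, with the convention `(i,0) = s`, `(i,b+1) = t`. -/
def node (b i j : ℕ) : DV :=
  if j = 0 then DV.s else if j = b + 1 then DV.t else DV.inner i j

/-- The arcs of the graph `D_{a,b}`. -/
def arc (a b : ℕ) : DV → DV → Prop := fun u v =>
  (∃ i, 1 ≤ i ∧ i ≤ a ∧
    ((u = DV.s ∧ v = DV.inner i 1) ∨ (u = DV.inner i 1 ∧ v = DV.s) ∨
     (u = DV.inner i b ∧ v = DV.t) ∨ (u = DV.t ∧ v = DV.inner i b))) ∨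
  (∃ i j, 1 ≤ i ∧ i ≤ a ∧ 1 ≤ j ∧ j < b ∧
    ((u = DV.inner i j ∧ v = DV.inner i (j + 1)) ∨
     (u = DV.inner i (j + 1) ∧ v = DV.inner i j))) ∨
  (∃ i j, 1 ≤ i ∧ i < a ∧ 2 ≤ j ∧ j ≤ b - 1 ∧ u = DV.inner i j ∧
    (v = node b (i + 1) (j - 2) ∨ v = node b (i + 1) (j + 2)))

/-- `p` is a (simple) directed path from `u` to `w` with respect to arc relation `E`,
given as the list of its vertices. -/
def DiPath {V : Type*} (E : V → V → Prop) (u w : V) (p : List V) : Prop :=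
  p.Chain' E ∧ p.head? = some u ∧ p.getLast? = some w ∧ p.Nodup

/-- `d` is a feasible solution of the Path-Blocking-LP for the digraph `E` with
terminals `s` and `t`. -/
def PBFeasible {V : Type*} (E : V → V → Prop) (s t : V) (d : V → ℝ) : Prop :=
  (∀ v, 0 ≤ d v) ∧ d s = 0 ∧ d t = 0 ∧
  ∀ (u : V) (P Q : List V), DiPath E u s P → DiPath E u t Q →
    1 ≤ (P.map d).sum + (Q.map d).sum - d u

/-- Number of internal vertices contributed by a vertex. -/
def cst : DV → ℕ
  | DV.inner _ _ => 1
  | DV.s => 0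
  | DV.t => 0

/-- Lower bound on the number of internal vertices on a path to `s`. -/
def potS (a b : ℕ) : DV → ℕ
  | DV.inner i j => if i = 0 then b + 1 else min (j + i - a) (b + 1 - a)
  | DV.s => 0
  | DV.t => b + 1 - a

/-- Lower bound on the number of internal vertices on a path to `t`. -/
def potT (a b : ℕ) : DV → ℕ
  | DV.inner i j => if i = 0 then b + 1 else min (b + 1 + i - j - a) (b + 1 - a)
  | DV.s => b + 1 - a
  | DV.t => 0

theorem pot_le {V : Type*} (E : V → V → Prop) (c f : V → ℕ) (w : V)
    (hf : ∀ u v, E u v → f u ≤ c u + f v) (hw : f w = 0) :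
    ∀ (p : List V) (u : V), p.IsChain E → p.head? = some u → p.getLast? = some w →
      f u ≤ (p.map c).sum := by
  intro p
  induction p with
  | nil => intro u _ h; simp at h
  | cons x l ih =>
    intro u hc hh hl
    simp only [List.head?_cons, Option.some.injEq] at hh
    subst hh
    cases l with
    | nil =>
      simp only [List.getLast?_singleton, Option.some.injEq] at hl
      subst hl
      omega
    | cons y l =>
      rw [List.isChain_cons_cons] at hc
      have h1 := ih y hc.2 rfl (by simpa [List.getLast?_cons_cons] using hl)
      have h2 := hf _ _ hc.1
      rw [List.map_cons, List.sum_cons]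
      omega

theorem potS_arc (a b : ℕ) (ha : 1 ≤ a) (hb : 2 * a ≤ b) (u v : DV) (h : arc a b u v) :
    potS a b u ≤ cst u + potS a b v := by
  rcases h with ⟨i, h1, h2, h⟩ | ⟨i, j, h1, h2, h3, h4, h⟩ | ⟨i, j, h1, h2, h3, h4, h5, h⟩
  · rcases h with ⟨rfl, rfl⟩ | ⟨rfl, rfl⟩ | ⟨rfl, rfl⟩ | ⟨rfl, rfl⟩ <;>
      simp only [potS, cst] <;> split_ifs <;> omega
  · rcases h with ⟨rfl, rfl⟩ | ⟨rfl, rfl⟩ <;> simp only [potS, cst] <;> split_ifs <;> omega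
  · subst h5
    rcases h with rfl | rfl <;> unfold node <;>
      [rcases Nat.eq_zero_or_pos (j - 2) with q | q;
        rcases Nat.eq_zero_or_pos (b - 1 - j) with q | q] <;>
      [rw [if_pos q]; rw [if_neg (by omega), if_neg (by omega)];
        rw [if_neg (by omega), if_pos (by omega)]; rw [if_neg (by omega), if_neg (by omega)]] <;>
      simp only [potS, cst, if_neg (show ¬ i = 0 by omega), Nat.add_eq_zero_iff, one_ne_zero,
        and_false, if_false] <;> omega

theorem potT_arc (a b : ℕ) (ha : 1 ≤ a) (hb : 2 * a ≤ b) (u v : DV) (h : arc a b u v) :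
    potT a b u ≤ cst u + potT a b v := by
  rcases h with ⟨i, h1, h2, h⟩ | ⟨i, j, h1, h2, h3, h4, h⟩ | ⟨i, j, h1, h2, h3, h4, h5, h⟩
  · rcases h with ⟨rfl, rfl⟩ | ⟨rfl, rfl⟩ | ⟨rfl, rfl⟩ | ⟨rfl, rfl⟩ <;>
      simp only [potT, cst] <;> split_ifs <;> omega
  · rcases h with ⟨rfl, rfl⟩ | ⟨rfl, rfl⟩ <;> simp only [potT, cst] <;> split_ifs <;> omega
  · subst h5
    rcases h with rfl | rfl <;> unfold node <;>
      [rcases Nat.eq_zero_or_pos (j - 2) with q | q;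
        rcases Nat.eq_zero_or_pos (b - 1 - j) with q | q] <;>
      [rw [if_pos q]; rw [if_neg (by omega), if_neg (by omega)];
        rw [if_neg (by omega), if_pos (by omega)]; rw [if_neg (by omega), if_neg (by omega)]] <;>
      simp only [potT, cst, if_neg (show ¬ i = 0 by omega), Nat.add_eq_zero_iff, one_ne_zero,
        and_false, if_false] <;> omega

theorem pot_sum (a b : ℕ) (ha : 1 ≤ a) (hb : 2 * a ≤ b) (u : DV) :
    (b - 2 * a + 1) + cst u ≤ potS a b u + potT a b u := by
  cases u <;> simp only [potS, potT, cst] <;> (try split_ifs) <;> omega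

theorem sum_cst (x : ℝ) (d : DV → ℝ) (hd : ∀ v, d v = cst v * x) (p : List DV) :
    (p.map d).sum = ((p.map cst).sum : ℕ) * x := by
  induction p with
  | nil => simp
  | cons y l ih => simp only [List.map_cons, List.sum_cons, ih, hd]; push_cast; ring

/-- for `a ≥ 1`, `b ≥ 2a` and `r = b - 2a + 1`, the function assigning
`1/r` to every internal vertex of `D_{a,b}` and `0` to `s` and `t` is feasible for the
Path-Blocking-LP on `D_{a,b}`. -/
theorem stmt_3 (a b : ℕ) (ha : 1 ≤ a) (hb : 2 * a ≤ b) :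
    PBFeasible (arc a b) DV.s DV.t
      (fun v => match v with
        | DV.s => (0 : ℝ)
        | DV.t => (0 : ℝ)
        | DV.inner _ _ => ((b - 2 * a + 1 : ℕ) : ℝ)⁻¹) := by
  refine ⟨?_, rfl, rfl, ?_⟩
  · intro v
    cases v <;> simp only [le_refl] <;> positivity
  · intro u P Q hP hQ
    have key : ∀ v : DV, (fun v => match v with
        | DV.s => (0 : ℝ)
        | DV.t => (0 : ℝ)
        | DV.inner _ _ => ((b - 2 * a + 1 : ℕ) : ℝ)⁻¹) v
          = cst v * ((b - 2 * a + 1 : ℕ) : ℝ)⁻¹ := by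
      intro v; cases v <;> simp [cst]
    rw [sum_cst _ _ key P, sum_cst _ _ key Q, key u]
    have h1 := pot_le _ cst _ DV.s (potS_arc a b ha hb) rfl P u hP.1 hP.2.1 hP.2.2.1
    have h2 := pot_le _ cst _ DV.t (potT_arc a b ha hb) rfl Q u hQ.1 hQ.2.1 hQ.2.2.1
    have h3 := pot_sum a b ha hb u
    have h4 : (b - 2 * a + 1) + cst u ≤ (P.map cst).sum + (Q.map cst).sum := by omega
    have hr : (0 : ℝ) < ((b - 2 * a + 1 : ℕ) : ℝ) := by positivity
    generalize b - 2 * a + 1 = r at *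
    have h5 : (r : ℝ) + cst u ≤ ((P.map cst).sum : ℕ) + ((Q.map cst).sum : ℕ) := by
      exact_mod_cast h4
    rw [← add_mul, ← sub_mul, ← div_eq_mul_inv, le_div_iff₀ hr]
    linarith
end

section
/- Let D=(V,E) be a finite directed graph with distinct vertices s,t ∈ V and let d : V → ℝ≥0 be feasible for the Path-Blocking-LP. Then for every vertex v ∈ V∖{s,t}, the set {θ ∈ (0,1/2) : v ∈ Δ^in(B^in(s,θ)) ∪ Δ^in(B^in(t,θ))} has Lebesgue measure at most d_v. -/
/-- `B^in(s, θ)`: the set of vertices having a directed path to `s` of `d`-distance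
at most `θ`. -/
def BinSet {V : Type*} (E : V → V → Prop) (d : V → ℝ) (s : V) (θ : ℝ) : Set V :=
  {v | ∃ p : List V, DiPath E v s p ∧ (p.map d).sum ≤ θ}

/-- `Δ^in(A)`: the set of vertices outside `A` having an arc into `A`. -/
def DeltaIn {V : Type*} (E : V → V → Prop) (A : Set V) : Set V :=
  {v | v ∉ A ∧ ∃ u ∈ A, E v u}

/-- A threshold at which `v` is in the in-boundary of a ball. -/
lemma delta_aux {V : Type*} (E : V → V → Prop) (r : V) (d : V → ℝ) (hd : ∀ v, 0 ≤ d v) (v : V)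
    (θ : ℝ) (h : v ∈ DeltaIn E (BinSet E d r θ)) :
    (∃ P, DiPath E v r P ∧ (P.map d).sum - d v ≤ θ) ∧
      ∀ P, DiPath E v r P → θ < (P.map d).sum := by
  obtain ⟨hv, u, ⟨p, ⟨hc, hh, hl, hn⟩, hs⟩, hE⟩ := h
  refine ⟨⟨v :: p, ⟨?_, rfl, ?_, ?_⟩, by simpa using hs⟩, ?_⟩
  · refine List.isChain_cons.2 ⟨?_, hc⟩
    intro y hy
    rw [hh] at hy
    cases hy
    exact hE
  · cases p with
    | nil => simp at hh
    | cons a l => simpa using hl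
  · refine List.nodup_cons.2 ⟨?_, hn⟩
    intro hvp
    obtain ⟨l1, l2, rfl⟩ := List.append_of_mem hvp
    apply hv
    refine ⟨v :: l2, ⟨(List.isChain_append.1 hc).2.1, rfl, ?_, (List.nodup_append.1 hn).2.1⟩, ?_⟩
    · rw [List.getLast?_append] at hl
      simpa using hl
    · have h1 : 0 ≤ (l1.map d).sum := by
        apply List.sum_nonneg
        intro x hx
        obtain ⟨y, _, rfl⟩ := List.mem_map.1 hx
        exact hd y
      rw [List.map_append, List.sum_append] at hs
      linarith
  · intro P hP
    by_contra hlt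
    exact hv ⟨P, hP, not_lt.1 hlt⟩

lemma single_aux (S : Set ℝ) (c : ℝ) (h0 : ∀ x ∈ S, 0 < x) (h : ∀ x ∈ S, ∀ y ∈ S, x ≤ y + c) :
    MeasureTheory.volume S ≤ ENNReal.ofReal c := by
  rcases S.eq_empty_or_nonempty with rfl | hne
  · simp
  have hb : BddBelow S := ⟨0, fun x hx => (h0 x hx).le⟩
  have hsub : S ⊆ Set.Icc (sInf S) (sInf S + c) := by
    intro x hx
    refine ⟨csInf_le hb hx, ?_⟩
    have : x - c ≤ sInf S := le_csInf hne fun y hy => by linarith [h x hx y hy]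
    linarith
  refine (MeasureTheory.measure_mono hsub).trans ?_
  simp [Real.volume_Icc]

lemma double_aux (S T : Set ℝ) (c : ℝ) (hS : S.Nonempty) (hT : T.Nonempty)
    (hS0 : S ⊆ Set.Ioo 0 (1 / 2)) (hT0 : T ⊆ Set.Ioo 0 (1 / 2))
    (h : ∀ x ∈ S, ∀ y ∈ T, 1 ≤ x + y + c) :
    MeasureTheory.volume (S ∪ T) ≤ ENNReal.ofReal c := by
  have key : ∀ S : Set ℝ, S.Nonempty → S ⊆ Set.Ioo 0 (1 / 2) →
      sInf S ≤ 1 / 2 ∧ MeasureTheory.volume S ≤ ENNReal.ofReal (1 / 2 - sInf S) := by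
    intro S hS hS0
    have hb : BddBelow S := ⟨0, fun x hx => (hS0 hx).1.le⟩
    constructor
    · obtain ⟨x, hx⟩ := hS
      exact (csInf_le hb hx).trans (hS0 hx).2.le
    · rw [← Real.volume_Icc]
      exact MeasureTheory.measure_mono fun x hx => ⟨csInf_le hb hx, (hS0 hx).2.le⟩
  obtain ⟨a1, a2⟩ := key S hS hS0
  obtain ⟨b1, b2⟩ := key T hT hT0
  have hab : 1 - c - sInf S ≤ sInf T := by
    refine le_csInf hT fun y hy => ?_
    have : 1 - c - y ≤ sInf S := le_csInf hS fun x hx => by linarith [h x hx y hy]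
    linarith
  refine (MeasureTheory.measure_union_le S T).trans ((add_le_add a2 b2).trans ?_)
  rw [← ENNReal.ofReal_add (by linarith) (by linarith)]
  exact ENNReal.ofReal_le_ofReal (by linarith)

/-- for feasible `d` and `v ∉ {s,t}`, the set of thresholds
`θ ∈ (0,1/2)` for which `v ∈ Δ^in(B^in(s,θ)) ∪ Δ^in(B^in(t,θ))` has Lebesgue measure
at most `d v`. -/
theorem stmt_6 {V : Type*} [Fintype V] (E : V → V → Prop) (s t : V) (hst : s ≠ t)
    (d : V → ℝ) (hd : PBFeasible E s t d) (v : V) (hvs : v ≠ s) (hvt : v ≠ t) :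
    MeasureTheory.volume
        {θ : ℝ | θ ∈ Set.Ioo (0 : ℝ) (1 / 2) ∧
          v ∈ DeltaIn E (BinSet E d s θ) ∪ DeltaIn E (BinSet E d t θ)} ≤
      ENNReal.ofReal (d v) := by
  obtain ⟨h0, -, -, hf⟩ := hd
  let S : V → Set ℝ := fun r => {θ | θ ∈ Set.Ioo (0 : ℝ) (1 / 2) ∧ v ∈ DeltaIn E (BinSet E d r θ)}
  have hU : {θ : ℝ | θ ∈ Set.Ioo (0 : ℝ) (1 / 2) ∧
          v ∈ DeltaIn E (BinSet E d s θ) ∪ DeltaIn E (BinSet E d t θ)} = S s ∪ S t := by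
    ext θ
    simp only [S, Set.mem_setOf_eq, Set.mem_union]
    tauto
  rw [hU]
  have hone : ∀ r, MeasureTheory.volume (S r) ≤ ENNReal.ofReal (d v) := by
    intro r
    refine single_aux _ _ (fun x hx => hx.1.1) fun x hx y hy => ?_
    obtain ⟨P, hP, hPs⟩ := (delta_aux E r d h0 v y hy.2).1
    have := (delta_aux E r d h0 v x hx.2).2 P hP
    linarith
  rcases (S s).eq_empty_or_nonempty with hs | hs
  · rw [hs, Set.empty_union]
    exact hone t
  rcases (S t).eq_empty_or_nonempty with ht | ht
  · rw [ht, Set.union_empty]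
    exact hone s
  refine double_aux _ _ _ hs ht (fun x hx => hx.1) (fun x hx => hx.1) fun x hx y hy => ?_
  obtain ⟨P, hP, hPs⟩ := (delta_aux E s d h0 v x hx.2).1
  obtain ⟨Q, hQ, hQs⟩ := (delta_aux E t d h0 v y hy.2).1
  have := hf v P Q hP hQ
  linarith
end
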